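/- For every real number Λ ≥ 0, Σ_{n=2}^∞ (e^{−Λ} Λⁿ / n!) · Σ_{k=0}^{n−2} (1/4)^k · (2/4) · (2/4)^{n−k−2} = 4 (e^{−Λ/4} − e^{−Λ/2})². -/

import Mathlib

theorem Real.hasSum_pow_div_factorial (x : ℝ) :
    HasSum (fun n : ℕ => x ^ n / (Nat.factorial n : ℝ)) (Real.exp x) := by
  rw [Real.exp_eq_exp_ℝ]
  exact NormedSpace.expSeries_div_hasSum_exp x

/-- The conditional probability of lying in the interior of the faces, given `m + 2` switches. -/
theorem sum_third_direction_weights (m : ℕ) :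
    ∑ k ∈ Finset.range (m + 1), (1 / 4 : ℝ) ^ k * (2 / 4 : ℝ) * (2 / 4 : ℝ) ^ (m - k)
      = 4 * (1 / 2) ^ (m + 2) - 8 * (1 / 4) ^ (m + 2) := by
  induction m with
  | zero => norm_num
  | succ m ih =>
    have h : ∀ k ∈ Finset.range (m + 1),
        (1 / 4 : ℝ) ^ k * (2 / 4 : ℝ) * (2 / 4 : ℝ) ^ (m + 1 - k)
          = ((1 / 4 : ℝ) ^ k * (2 / 4 : ℝ) * (2 / 4 : ℝ) ^ (m - k)) * (1 / 2) := by
      intro k hk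
      rw [Nat.succ_sub (Nat.lt_succ_iff.mp (Finset.mem_range.mp hk)), pow_succ]
      ring
    rw [Finset.sum_range_succ, Finset.sum_congr rfl h, ← Finset.sum_mul, ih, Nat.sub_self]
    ring

theorem OSM_face_probability (L : ℝ) (hL : 0 ≤ L) :
    ∑' m : ℕ, (Real.exp (-L) * L ^ (m + 2) / (Nat.factorial (m + 2) : ℝ))
        * ∑ k ∈ Finset.range (m + 1),
            (1 / 4 : ℝ) ^ k * (2 / 4 : ℝ) * (2 / 4 : ℝ) ^ (m - k)
    = 4 * (Real.exp (-L / 4) - Real.exp (-L / 2)) ^ 2 := by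
  have h := ((((Real.hasSum_pow_div_factorial (L / 2)).mul_left 4).sub
    ((Real.hasSum_pow_div_factorial (L / 4)).mul_left 8)).mul_left (Real.exp (-L)))
  have h2 := (hasSum_nat_add_iff' 2).mpr h
  have hval : 4 * (Real.exp (-L / 4) - Real.exp (-L / 2)) ^ 2
      = Real.exp (-L) * (4 * Real.exp (L / 2) - 8 * Real.exp (L / 4)) + 4 * Real.exp (-L) := by
    have e1 : Real.exp (-L) = Real.exp (-L / 4) ^ 4 := by
      rw [← Real.exp_nat_mul]; congr 1; push_cast; ring
    have e2 : Real.exp (-L / 2) = Real.exp (-L / 4) ^ 2 := by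
      rw [← Real.exp_nat_mul]; congr 1; push_cast; ring
    have e3 : Real.exp (L / 2) = Real.exp (L / 4) ^ 2 := by
      rw [← Real.exp_nat_mul]; congr 1; push_cast; ring
    have e4 : Real.exp (-L / 4) = (Real.exp (L / 4))⁻¹ := by
      rw [← Real.exp_neg]; congr 1; ring
    rw [e1, e2, e3, e4]
    have := Real.exp_ne_zero (L / 4)
    field_simp
    ring
  rw [hval]
  convert h2.tsum_eq using 1
  · refine tsum_congr fun m => ?_
    rw [sum_third_direction_weights, div_pow L 2, div_pow L 4, one_div_pow, one_div_pow]
    ring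
  · simp [Finset.sum_range_succ]
    ring
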